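/- Let W be an open neighborhood of a point x in ℝ^d_+ = {y ∈ ℝ^d : y_i ≥ 0 for all i} and let C ⊆ W be a compact set containing x. Then there exists an open set V (open in ℝ^d_+) satisfying x ∈ C ⊆ V ⊆ V̄ ⊆ W whose closure V̄ is a compact manifold with corners; in fact V̄ can be taken to be a finite union of closed axis-parallel cubes intersected with ℝ^d_+. -/

import Mathlib

open Set Filter Topology

universe u v w

/-! ## Michal–Bastiani calculus on locally convex spaces -/

section Calculus

variable {E : Type*} [AddCommGroup E] [Module ℝ E] [TopologicalSpace E]
variable {F : Type*} [AddCommGroup F] [Module ℝ F] [TopologicalSpace F]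

/-- A map `f : E → F` between topological `ℝ`-vector spaces is Michal–Bastiani smooth on a
set `U` (intended to be open) if it is continuous on `U` and there is a family of iterated
directional differentials `D n (x, v)` (depending on the directions `v 0, …, v (n-1)`),
starting with `f` itself, such that each `D (n+1)` arises from `D n` as a difference
quotient limit in the direction `v n`, and each `D n` is continuous on `U × E^ℕ`. -/
def MBSmoothOn (f : E → F) (U : Set E) : Prop :=
  ContinuousOn f U ∧
  ∃ D : ℕ → E × (ℕ → E) → F,
    (∀ x v, D 0 (x, v) = f x) ∧
    (∀ (n : ℕ) (x : E) (v : ℕ → E), x ∈ U →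
      Tendsto (fun h : ℝ => h⁻¹ • (D n (x + h • v n, v) - D n (x, v)))
        (𝓝[≠] (0 : ℝ)) (𝓝 (D (n + 1) (x, v)))) ∧
    (∀ n : ℕ, ContinuousOn (D n) (U ×ˢ (univ : Set (ℕ → E))))

/-- A map is smooth on an arbitrary (not necessarily open) set `A` if around each point of
`A` it admits a local extension which is Michal–Bastiani smooth on an open neighborhood. -/
def MBSmoothOnSet (f : E → F) (A : Set E) : Prop :=
  ∀ x ∈ A, ∃ (U : Set E) (g : E → F),
    IsOpen U ∧ x ∈ U ∧ MBSmoothOn g U ∧ EqOn f g (A ∩ U)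

end Calculus

/-! ## Charted spaces modeled on locally convex spaces, manifolds with corners, Lie groups -/

/-- A charted space structure on `X` modeled on a topological `ℝ`-vector space `E`:
an atlas of partial homeomorphisms onto subsets of `E` with smooth coordinate changes.
The targets are not required to be open, so this covers manifolds with corners as well. -/
structure ChartedLC (E : Type u) [AddCommGroup E] [Module ℝ E] [TopologicalSpace E]
    (X : Type v) [TopologicalSpace X] where
  charts : Set (PartialEquiv X E)
  source_open : ∀ c ∈ charts, IsOpen c.source
  continuousOn_toFun : ∀ c ∈ charts, ContinuousOn c c.source
  continuousOn_invFun : ∀ c ∈ charts, ContinuousOn c.symm c.target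
  chart_cover : ∀ x : X, ∃ c ∈ charts, x ∈ c.source
  compat : ∀ c ∈ charts, ∀ c' ∈ charts,
    MBSmoothOnSet (↑c' ∘ c.symm) (c.target ∩ c.symm ⁻¹' c'.source)

/-- Smoothness of a map between charted spaces, on a subset `A` of the source:
continuity on `A` together with smoothness of all local chart representatives. -/
def ChartedLC.SmoothOn {E : Type u} [AddCommGroup E] [Module ℝ E] [TopologicalSpace E]
    {X : Type v} [TopologicalSpace X]
    {F : Type u'} [AddCommGroup F] [Module ℝ F] [TopologicalSpace F]
    {Y : Type v'} [TopologicalSpace Y]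
    (XA : ChartedLC E X) (YA : ChartedLC F Y) (f : X → Y) (A : Set X) : Prop :=
  ContinuousOn f A ∧
  ∀ x ∈ A, ∃ c ∈ XA.charts, x ∈ c.source ∧ ∃ c' ∈ YA.charts, f x ∈ c'.source ∧
    MBSmoothOnSet (↑c' ∘ f ∘ c.symm)
      (c.target ∩ c.symm ⁻¹' (A ∩ c.source ∩ f ⁻¹' c'.source))

/-- The model quadrant `ℝ^d_+`. -/
def Rplus (d : ℕ) : Set (Fin d → ℝ) := {x | ∀ i, 0 ≤ x i}

/-- A `d`-dimensional manifold with corners: a charted space modeled on `ℝ^d` whose chart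
targets are (relatively) open subsets of the quadrant `ℝ^d_+`, with smooth (in the sense of
local extensions) coordinate changes. (Paracompactness is imposed via `ParacompactSpace`.) -/
structure CornersManifold (d : ℕ) (M : Type v) [TopologicalSpace M]
    extends ChartedLC (Fin d → ℝ) M where
  target_subset : ∀ c ∈ charts, c.target ⊆ Rplus d
  target_relOpen : ∀ c ∈ charts, ∃ O : Set (Fin d → ℝ), IsOpen O ∧ c.target = O ∩ Rplus d

/-- A smooth manifold modeled on a topological `ℝ`-vector space: all chart targets open. -/
structure LCManifold (E : Type u) [AddCommGroup E] [Module ℝ E] [TopologicalSpace E]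
    (X : Type v) [TopologicalSpace X] extends ChartedLC E X where
  target_open : ∀ c ∈ charts, IsOpen c.target

/-- A Lie group modeled on a topological `ℝ`-vector space `E` (in the applications, a locally
convex space): a group with a smooth manifold structure such that multiplication and
inversion are smooth, expressed in charts. -/
structure LieGroupLC (E : Type u) [AddCommGroup E] [Module ℝ E] [TopologicalSpace E]
    (K : Type v) [TopologicalSpace K] [Group K] extends LCManifold E K where
  smooth_mul : ∀ a b : K, ∃ c ∈ charts, a ∈ c.source ∧ ∃ c' ∈ charts, b ∈ c'.source ∧
    ∃ c'' ∈ charts, a * b ∈ c''.source ∧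
      MBSmoothOnSet (fun p : E × E => c'' (c.symm p.1 * c'.symm p.2))
        {p : E × E | p.1 ∈ c.target ∧ p.2 ∈ c'.target ∧ c.symm p.1 * c'.symm p.2 ∈ c''.source}
  smooth_inv : ∀ a : K, ∃ c ∈ charts, a ∈ c.source ∧ ∃ c' ∈ charts, a⁻¹ ∈ c'.source ∧
    MBSmoothOnSet (fun e : E => c' (c.symm e)⁻¹)
      {e : E | e ∈ c.target ∧ (c.symm e)⁻¹ ∈ c'.source}

/-! ## Principal bundles -/

/-- Raw data of a bundle over `M` with structure group `K`: a total space with a topology,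
a right `K`-action and a projection. -/
structure BundleData (K : Type u) (M : Type v) : Type (max u v (w + 1)) where
  total : Type w
  top : TopologicalSpace total
  act : total → K → total
  proj : total → M

section Bundles

variable {K : Type u} [TopologicalSpace K] [Group K] {M : Type v} [TopologicalSpace M]

/-- `Φ` is a local trivialization of `B` over `U ⊆ M`: an equivariant homeomorphism
`proj⁻¹(U) → U × K` over `U`. -/
def BundleData.IsTrivOver (B : BundleData.{u, v, w} K M) (U : Set M)
    (Φ : PartialEquiv B.total (M × K)) : Prop :=
  letI := B.top
  Φ.source = B.proj ⁻¹' U ∧ Φ.target = U ×ˢ (univ : Set K) ∧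
  ContinuousOn Φ Φ.source ∧ ContinuousOn Φ.symm Φ.target ∧
  (∀ p ∈ Φ.source, (Φ p).1 = B.proj p) ∧
  (∀ p ∈ Φ.source, ∀ k : K, Φ (B.act p k) = ((Φ p).1, (Φ p).2 * k))

/-- `B` is a continuous principal `K`-bundle over `M`. -/
def BundleData.IsCont (B : BundleData.{u, v, w} K M) : Prop :=
  letI := B.top
  Continuous (fun q : B.total × K => B.act q.1 q.2) ∧
  Continuous B.proj ∧
  (∀ p, B.act p 1 = p) ∧
  (∀ p k k', B.act (B.act p k) k' = B.act p (k * k')) ∧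
  (∀ p k, B.proj (B.act p k) = B.proj p) ∧
  ∀ x : M, ∃ (U : Set M) (Φ : PartialEquiv B.total (M × K)),
    IsOpen U ∧ x ∈ U ∧ B.IsTrivOver U Φ

/-- The transition function of two local trivializations `Φ, Ψ`, determined by
`Ψ⁻¹(x, e) ⋅ k(x) = ...`, concretely `k(x) = pr₂(Φ(Ψ⁻¹(x, e)))`. -/
def BundleData.transFun (B : BundleData.{u, v, w} K M) (Φ Ψ : PartialEquiv B.total (M × K))
    (x : M) : K :=
  (Φ (Ψ.symm (x, 1))).2

/-- `B` is smooth over the subset `A ⊆ M` (with respect to charted structures on `M` and `K`):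
there are local trivializations over open subsets of `A` covering `A` whose transition
functions are smooth. -/
def BundleData.IsSmoothOn {G : Type u'} [AddCommGroup G] [Module ℝ G] [TopologicalSpace G]
    {E : Type u''} [AddCommGroup E] [Module ℝ E] [TopologicalSpace E]
    (B : BundleData.{u, v, w} K M) (MA : ChartedLC G M) (KA : ChartedLC E K)
    (A : Set M) : Prop :=
  ∃ (ι : Type v) (U : ι → Set M) (Φ : ι → PartialEquiv B.total (M × K)),
    (∀ i, IsOpen (U i)) ∧ (∀ i, U i ⊆ A) ∧ A ⊆ ⋃ i, U i ∧
    (∀ i, B.IsTrivOver (U i) (Φ i)) ∧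
    ∀ i j, ChartedLC.SmoothOn MA KA (B.transFun (Φ i) (Φ j)) (U i ∩ U j)

/-- `B` is a smooth principal `K`-bundle. -/
def BundleData.IsSmooth {G : Type u'} [AddCommGroup G] [Module ℝ G] [TopologicalSpace G]
    {E : Type u''} [AddCommGroup E] [Module ℝ E] [TopologicalSpace E]
    (B : BundleData.{u, v, w} K M) (MA : ChartedLC G M) (KA : ChartedLC E K) : Prop :=
  B.IsSmoothOn MA KA univ

/-- A continuous bundle equivalence: an equivariant homeomorphism covering `id_M`. -/
def IsContBundleEquiv (B : BundleData.{u, v, w} K M) (B' : BundleData.{u, v, w'} K M)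
    (Ω : B.total → B'.total) : Prop :=
  letI := B.top
  letI := B'.top
  Continuous Ω ∧ (∀ p k, Ω (B.act p k) = B'.act (Ω p) k) ∧
  (∀ p, B'.proj (Ω p) = B.proj p) ∧
  ∃ Ψ : B'.total → B.total, Continuous Ψ ∧
    Function.LeftInverse Ψ Ω ∧ Function.RightInverse Ψ Ω

/-- The local representative `f(x) = pr₂(Φ'(Ω(Φ⁻¹(x, e))))` of a bundle map `Ω` with respect
to local trivializations `Φ` of the source and `Φ'` of the target bundle. -/
def equivLocalRep (B : BundleData.{u, v, w} K M) (B' : BundleData.{u, v, w'} K M)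
    (Ω : B.total → B'.total) (Φ : PartialEquiv B.total (M × K))
    (Φ' : PartialEquiv B'.total (M × K)) (x : M) : K :=
  (Φ' (Ω (Φ.symm (x, 1)))).2

/-- A bundle map `Ω` between (smooth) bundles is smooth over `A ⊆ M` if, with respect to
suitable smooth systems of local trivializations of both bundles over a common cover, all its
local representatives are smooth on `A`. -/
def IsSmoothBundleEquivOn {G : Type u'} [AddCommGroup G] [Module ℝ G] [TopologicalSpace G]
    {E : Type u''} [AddCommGroup E] [Module ℝ E] [TopologicalSpace E]
    (MA : ChartedLC G M) (KA : ChartedLC E K)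
    (B : BundleData.{u, v, w} K M) (B' : BundleData.{u, v, w'} K M)
    (Ω : B.total → B'.total) (A : Set M) : Prop :=
  ∃ (ι : Type v) (U : ι → Set M) (Φ : ι → PartialEquiv B.total (M × K))
    (Φ' : ι → PartialEquiv B'.total (M × K)),
    (∀ i, IsOpen (U i)) ∧ (⋃ i, U i) = univ ∧
    (∀ i, B.IsTrivOver (U i) (Φ i)) ∧ (∀ i, B'.IsTrivOver (U i) (Φ' i)) ∧
    (∀ i j, ChartedLC.SmoothOn MA KA (B.transFun (Φ i) (Φ j)) (U i ∩ U j)) ∧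
    (∀ i j, ChartedLC.SmoothOn MA KA (B'.transFun (Φ' i) (Φ' j)) (U i ∩ U j)) ∧
    ∀ i, ChartedLC.SmoothOn MA KA (equivLocalRep B B' Ω (Φ i) (Φ' i)) (U i ∩ A)

/-- A smooth bundle equivalence. -/
def IsSmoothBundleEquiv {G : Type u'} [AddCommGroup G] [Module ℝ G] [TopologicalSpace G]
    {E : Type u''} [AddCommGroup E] [Module ℝ E] [TopologicalSpace E]
    (MA : ChartedLC G M) (KA : ChartedLC E K)
    (B : BundleData.{u, v, w} K M) (B' : BundleData.{u, v, w'} K M)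
    (Ω : B.total → B'.total) : Prop :=
  IsContBundleEquiv B B' Ω ∧ IsSmoothBundleEquivOn MA KA B B' Ω univ

end Bundles

/-- The closed axis-parallel cube of radius `ε` around `x`, intersected with the
quadrant `ℝ^d_+`. -/
def cornerCube {d : ℕ} (x : Fin d → ℝ) (ε : ℝ) : Set (Fin d → ℝ) :=
  {y | ∀ i, y i ∈ Icc (x i - ε) (x i + ε)} ∩ Rplus d

open scoped ContDiff

section SmoothCharts

variable {E F : Type*} [NormedAddCommGroup E] [NormedSpace ℝ E]
  [NormedAddCommGroup F] [NormedSpace ℝ F]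

theorem ContDiffOn.mbSmoothOn {f : E → F} {U : Set E} (hU : IsOpen U)
    (hf : ContDiffOn ℝ ∞ f U) : MBSmoothOn f U := by
  refine ⟨hf.continuousOn,
    fun n p => iteratedFDeriv ℝ n f p.1 (fun i => p.2 (Fin.rev i : Fin n)), ?_, ?_, ?_⟩
  · intro x v
    simp
  · intro n x v hx
    have hd : DifferentiableAt ℝ (iteratedFDeriv ℝ n f) x :=
      (hf.contDiffAt (hU.mem_nhds hx)).differentiableAt_iteratedFDeriv
        (by exact_mod_cast WithTop.coe_lt_top _)
    have hl := (hd.hasFDerivAt.hasLineDerivAt (v n)).tendsto_slope_zero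
    have hc : Continuous fun g : E [×n]→L[ℝ] F => g (fun i => v (Fin.rev i : Fin n)) :=
      continuous_eval_const _
    have := (hc.tendsto _).comp hl
    simp only [iteratedFDeriv_succ_apply_left]
    refine (this.congr fun h => ?_).trans (le_of_eq ?_)
    · simp
    · congr 1
      have h0 : ((Fin.rev (0 : Fin (n + 1)) : Fin (n + 1)) : ℕ) = n := by simp
      rw [h0]
      congr 1
      funext i
      simp [Fin.tail]
  · intro n
    have h1 : ContinuousOn (iteratedFDeriv ℝ n f) U := by
      refine (hf.continuousOn_iteratedFDerivWithin (m := n)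
        (by exact_mod_cast le_top) hU.uniqueDiffOn).congr fun y hy => ?_
      exact (iteratedFDerivWithin_of_isOpen n hU hy).symm
    have h2 : ContinuousOn (fun p : E × (ℕ → E) => iteratedFDeriv ℝ n f p.1) (U ×ˢ univ) :=
      h1.comp continuousOn_fst fun p hp => hp.1
    exact h2.eval (by fun_prop)

end SmoothCharts

/-- A space embedded in `ℝ^d` with image straightened locally onto `ℝ^d_+` by ambient
diffeomorphisms is a manifold with corners. -/
theorem nonempty_cornersManifold_of_isEmbedding {d : ℕ} {X : Type*} [TopologicalSpace X]
    {H : X → Fin d → ℝ} (hH : IsEmbedding H)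
    (hloc : ∀ x, ∃ c : OpenPartialHomeomorph (Fin d → ℝ) (Fin d → ℝ), H x ∈ c.source ∧
      ContDiffOn ℝ ∞ c c.source ∧ ContDiffOn ℝ ∞ c.symm c.target ∧
      ∀ y ∈ c.source, y ∈ range H ↔ c y ∈ Rplus d) :
    Nonempty (CornersManifold d X) := by
  classical
  rcases isEmpty_or_nonempty X with hX | hX
  · exact ⟨{ charts := ∅, source_open := by simp, continuousOn_toFun := by simp,
             continuousOn_invFun := by simp, chart_cover := fun x => hX.elim x,
             compat := by simp, target_subset := by simp, target_relOpen := by simp }⟩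
  choose c hxc hcs hcs' hcN using hloc
  have hsymm : ∀ x, ∀ y ∈ (c x).target ∩ Rplus d,
      H (Function.invFun H ((c x).symm y)) = (c x).symm y := by
    intro x y hy
    apply Function.invFun_eq
    change (c x).symm y ∈ range H
    rw [hcN x _ ((c x).map_target hy.1), (c x).right_inv hy.1]
    exact hy.2
  let e : X → PartialEquiv X (Fin d → ℝ) := fun x =>
    { toFun := fun z => c x (H z)
      invFun := fun y => Function.invFun H ((c x).symm y)
      source := H ⁻¹' (c x).source
      target := (c x).target ∩ Rplus d
      map_source' := fun z hz => ⟨(c x).map_source hz, (hcN x _ hz).1 ⟨z, rfl⟩⟩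
      map_target' := fun y hy => by
        rw [mem_preimage, hsymm x y hy]
        exact (c x).map_target hy.1
      left_inv' := fun z hz => by
        rw [(c x).left_inv hz]
        exact Function.leftInverse_invFun hH.injective z
      right_inv' := fun y hy => by
        rw [hsymm x y hy, (c x).right_inv hy.1] }
  refine ⟨{ charts := range e, source_open := ?_, continuousOn_toFun := ?_,
            continuousOn_invFun := ?_, chart_cover := fun x => ⟨e x, ⟨x, rfl⟩, hxc x⟩,
            compat := ?_, target_subset := ?_, target_relOpen := ?_ }⟩
  · rintro _ ⟨x, rfl⟩
    exact (c x).open_source.preimage hH.continuous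
  · rintro _ ⟨x, rfl⟩
    exact (c x).continuousOn.comp hH.continuous.continuousOn fun z hz => hz
  · rintro _ ⟨x, rfl⟩
    rw [hH.isInducing.continuousOn_iff]
    exact ((c x).continuousOn_symm.mono inter_subset_left).congr (hsymm x)
  · rintro _ ⟨x, rfl⟩ _ ⟨x', rfl⟩ y hy
    have hy' : (c x).symm y ∈ (c x').source := by
      rw [← hsymm x y hy.1]
      exact hy.2
    refine ⟨(c x).target ∩ (c x).symm ⁻¹' (c x').source, c x' ∘ (c x).symm,
      (c x).isOpen_inter_preimage_symm (c x').open_source, ⟨hy.1.1, hy'⟩,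
      ContDiffOn.mbSmoothOn ((c x).isOpen_inter_preimage_symm (c x').open_source)
        ((hcs x').comp ((hcs' x).mono inter_subset_left) fun z hz => hz.2), ?_⟩
    rintro z ⟨hz, -⟩
    exact congrArg (c x') (hsymm x z hz.1)
  · rintro _ ⟨x, rfl⟩
    exact inter_subset_right
  · rintro _ ⟨x, rfl⟩
    exact ⟨(c x).target, (c x).open_target, rfl⟩

/-- Replacing the `i`-th coordinate by a function with nonvanishing `i`-th partial derivative
is a local diffeomorphism. -/
theorem exists_openPartialHomeomorph_update {d : ℕ} {F : (Fin d → ℝ) → ℝ}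
    (hF : ContDiff ℝ ∞ F) {p : Fin d → ℝ} {i : Fin d}
    (hi : fderiv ℝ F p (Pi.single i 1) ≠ 0) :
    ∃ c : OpenPartialHomeomorph (Fin d → ℝ) (Fin d → ℝ), p ∈ c.source ∧
      (∀ y, c y = Function.update y i (F y)) ∧
      ContDiffOn ℝ ∞ c c.source ∧ ContDiffOn ℝ ∞ c.symm c.target := by
  set g : (Fin d → ℝ) → Fin d → ℝ := fun y => Function.update y i (F y) with hg
  have hgs : ContDiff ℝ ∞ g := by
    rw [contDiff_pi]
    intro j
    rcases eq_or_ne j i with rfl | hj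
    · simpa [hg] using hF
    · simpa [hg, Function.update_of_ne hj] using contDiff_apply ℝ ℝ j
  have hdiff : Differentiable ℝ F := hF.differentiable (by simp)
  have hgd : Differentiable ℝ g := hgs.differentiable (by simp)
  have hderiv : ∀ y v j, fderiv ℝ g y v j = Function.update v i (fderiv ℝ F y v) j := by
    intro y v j
    have h1 := (hasFDerivAt_pi'.1 (hgd y).hasFDerivAt) j
    rcases eq_or_ne j i with rfl | hj
    · have h2 : HasFDerivAt (fun y => g y j) (fderiv ℝ F y) y := by
        simpa [hg] using (hdiff y).hasFDerivAt
      simpa using congrArg (fun L => L v) (h1.unique h2)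
    · have h2 : HasFDerivAt (fun y => g y j) (ContinuousLinearMap.proj (R := ℝ) j) y := by
        simpa [hg, Function.update_of_ne hj] using hasFDerivAt_apply (𝕜 := ℝ) j y
      simpa [Function.update_of_ne hj] using congrArg (fun L => L v) (h1.unique h2)
  have hequiv : ∀ y, fderiv ℝ F y (Pi.single i 1) ≠ 0 →
      ∃ L : (Fin d → ℝ) ≃L[ℝ] (Fin d → ℝ), HasFDerivAt g (L : (Fin d → ℝ) →L[ℝ] _) y := by
    intro y hy
    have hinj : Function.Injective (fderiv ℝ g y : (Fin d → ℝ) →ₗ[ℝ] (Fin d → ℝ)) := by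
      rw [← LinearMap.ker_eq_bot, LinearMap.ker_eq_bot']
      intro v hv
      have hv' : ∀ j, Function.update v i (fderiv ℝ F y v) j = 0 := fun j => by
        rw [← hderiv]; exact congrFun hv j
      have hvi : v = Pi.single i (v i) := by
        funext j
        rcases eq_or_ne j i with rfl | hj
        · simp
        · simpa [Function.update_of_ne hj, Pi.single_eq_of_ne hj] using hv' j
      have h0 := hv' i
      rw [Function.update_self, hvi, show (Pi.single i (v i) : Fin d → ℝ)
        = v i • Pi.single i 1 by simp [← Pi.single_smul], map_smul, smul_eq_mul] at h0
      have : v i = 0 := by simpa [hy] using h0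
      rw [hvi, this, Pi.single_zero]
    refine ⟨(LinearEquiv.ofInjectiveEndo _ hinj).toContinuousLinearEquiv, ?_⟩
    convert (hgd y).hasFDerivAt using 1
    ext v
    rfl
  obtain ⟨L, hL⟩ := hequiv p hi
  have hne : (∞ : WithTop ℕ∞) ≠ 0 := by simp
  let c₀ := hgs.contDiffAt.toOpenPartialHomeomorph g hL hne
  have hcont : Continuous fun y => fderiv ℝ F y (Pi.single i 1) :=
    (hF.continuous_fderiv hne).clm_apply continuous_const
  have hopen : IsOpen {y | fderiv ℝ F y (Pi.single i 1) ≠ 0} :=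
    isOpen_ne_fun hcont continuous_const
  let c := c₀.restrOpen _ hopen
  have hc : ∀ y, c y = g y := fun y => rfl
  refine ⟨c, ⟨hgs.contDiffAt.mem_toOpenPartialHomeomorph_source hL hne, hi⟩, hc,
    hgs.contDiffOn, fun y hy => ?_⟩
  have hy' : c.symm y ∈ c.source := c.map_target hy
  obtain ⟨L', hL'⟩ := hequiv (c.symm y) hy'.2
  exact (c.contDiffAt_symm hy hL' hgs.contDiffAt).contDiffWithinAt

/-- A regular superlevel set within `ℝ^d_+` whose boundary is transverse to the faces of `ℝ^d_+`
is a manifold with corners. -/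
theorem nonempty_cornersManifold_of_superlevel {d : ℕ} {X : Type*} [TopologicalSpace X]
    {H : X → Fin d → ℝ} (hH : IsEmbedding H) {F : (Fin d → ℝ) → ℝ} (hF : ContDiff ℝ ∞ F)
    (hrange : range H = {y | 0 ≤ F y} ∩ Rplus d)
    (hreg : ∀ p ∈ Rplus d, F p = 0 → ∃ i, 0 < p i ∧ fderiv ℝ F p (Pi.single i 1) ≠ 0) :
    Nonempty (CornersManifold d X) := by
  refine nonempty_cornersManifold_of_isEmbedding hH fun x => ?_
  have hx : H x ∈ {y | 0 ≤ F y} ∩ Rplus d := hrange ▸ mem_range_self x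
  rw [hrange]
  rcases (show 0 ≤ F (H x) from hx.1).lt_or_eq with hpos | hzero
  · refine ⟨OpenPartialHomeomorph.ofSet {y | 0 < F y}
      (isOpen_lt continuous_const hF.continuous), hpos, contDiff_id.contDiffOn,
      contDiff_id.contDiffOn, fun y hy => ?_⟩
    have hy : 0 < F y := hy
    simp [hy.le]
  · obtain ⟨i, hi, hd⟩ := hreg _ hx.2 hzero.symm
    obtain ⟨c, hpc, hcy, hcs, hcs'⟩ := exists_openPartialHomeomorph_update hF hd
    have hopen : IsOpen {y : Fin d → ℝ | 0 < y i} :=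
      isOpen_lt continuous_const (continuous_apply i)
    refine ⟨c.restrOpen _ hopen, ⟨hpc, hi⟩, hcs.mono inter_subset_left,
      hcs'.mono inter_subset_left, ?_⟩
    rintro y ⟨-, hy⟩
    have hy : 0 < y i := hy
    change _ ↔ c y ∈ Rplus d
    rw [hcy]
    constructor
    · rintro ⟨h1, h2⟩ j
      rcases eq_or_ne j i with rfl | hj
      · simpa using h1
      · simpa [Function.update_of_ne hj] using h2 j
    · intro h
      refine ⟨by simpa using h i, fun j => ?_⟩
      rcases eq_or_ne j i with rfl | hj
      · exact hy.le
      · simpa [Function.update_of_ne hj] using h j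

section Flow

variable {X : Type*}

/-- The first time in `[-B, B]` at which the orbit of `q` lies in `M`, and `B` if there is none. -/
noncomputable def entryTime (Φ : ℝ → X → X) (M : Set X) (B : ℝ) (q : X) : ℝ :=
  sInf ({t | t ∈ Icc (-B) B ∧ Φ t q ∈ M} ∪ {B})

variable {Φ : ℝ → X → X} {M : Set X} {B : ℝ} {q : X}

theorem entryTime_mem (hB : 0 ≤ B) : entryTime Φ M B q ∈ Icc (-B) B := by
  constructor
  · refine le_csInf ⟨B, Or.inr rfl⟩ ?_
    rintro t (ht | rfl)
    · exact ht.1.1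
    · linarith
  · refine csInf_le ⟨-B, ?_⟩ (Or.inr rfl)
    rintro t (ht | rfl)
    · exact ht.1.1
    · change -t ≤ t
      linarith

variable [TopologicalSpace X]

/-- A flow which carries the closed set `M` into its interior in positive time. -/
structure IsInwardFlow (Φ : ℝ → X → X) (M : Set X) : Prop where
  continuous : Continuous (Function.uncurry Φ)
  zero : ∀ q, Φ 0 q = q
  add : ∀ s t q, Φ (s + t) q = Φ s (Φ t q)
  closed : IsClosed M
  inward : ∀ q ∈ M, ∀ t, 0 < t → Φ t q ∈ interior M

namespace IsInwardFlow

theorem mono (h : IsInwardFlow Φ M) {s t : ℝ} (hst : s ≤ t) (hs : Φ s q ∈ M) : Φ t q ∈ M := by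
  rcases hst.eq_or_lt with rfl | hlt
  · exact hs
  · have := h.inward _ hs (t - s) (by linarith)
    rw [← h.add, sub_add_cancel] at this
    exact interior_subset this

theorem entryTime_le_iff (h : IsInwardFlow Φ M) {t : ℝ} (h1 : -B ≤ t) (h2 : t < B) :
    entryTime Φ M B q ≤ t ↔ Φ t q ∈ M := by
  have hbdd : BddBelow ({t | t ∈ Icc (-B) B ∧ Φ t q ∈ M} ∪ {B}) := by
    refine ⟨-B, ?_⟩
    rintro s (hs | rfl)
    · exact hs.1.1
    · linarith
  constructor
  · intro hle
    have key : ∀ s ∈ Ioo t B, Φ s q ∈ M := by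
      intro s hs
      obtain ⟨r, hr, hrs⟩ := exists_lt_of_csInf_lt (⟨B, Or.inr rfl⟩ : Set.Nonempty _)
        (lt_of_le_of_lt hle hs.1)
      rcases hr with hr | rfl
      · exact h.mono hrs.le hr.2
      · exact absurd hrs hs.2.le.not_gt
    have hc : Tendsto (fun s => Φ s q) (𝓝[>] t) (𝓝 (Φ t q)) :=
      ((h.continuous.comp (continuous_id.prodMk continuous_const)).tendsto t).mono_left
        nhdsWithin_le_nhds
    refine h.closed.mem_of_tendsto hc ?_
    filter_upwards [Ioo_mem_nhdsGT h2] with s hs using key s hs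
  · intro ht
    exact csInf_le hbdd (Or.inl ⟨⟨h1, h2.le⟩, ht⟩)

theorem continuous_entryTime (h : IsInwardFlow Φ M) (hB : 0 ≤ B) :
    Continuous (entryTime Φ M B) := by
  have hΦ : ∀ t, Continuous (Φ t) := fun t =>
    h.continuous.comp (continuous_const.prodMk continuous_id)
  rw [continuous_iff_continuousAt]
  intro q
  refine tendsto_order.2 ⟨fun s hs => ?_, fun s hs => ?_⟩
  · rcases lt_or_ge s (-B) with h1 | h1
    · exact Eventually.of_forall fun p => h1.trans_le (entryTime_mem hB).1
    have h2 : s < B := hs.trans_le (entryTime_mem hB).2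
    have hopen : IsOpen (Φ s ⁻¹' M)ᶜ := (h.closed.preimage (hΦ s)).isOpen_compl
    have hq : q ∈ (Φ s ⁻¹' M)ᶜ := fun hq => hs.not_ge ((h.entryTime_le_iff h1 h2).2 hq)
    filter_upwards [hopen.mem_nhds hq] with p hp
    exact not_le.1 fun hle => hp ((h.entryTime_le_iff h1 h2).1 hle)
  · rcases lt_or_ge B s with h1 | h1
    · exact Eventually.of_forall fun p => (entryTime_mem hB).2.trans_lt h1
    obtain ⟨r, hr, hrs⟩ := exists_between hs
    obtain ⟨r', hr', hrs'⟩ := exists_between hrs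
    have hlow : -B ≤ entryTime Φ M B q := (entryTime_mem hB).1
    have hr0 : Φ r q ∈ M := (h.entryTime_le_iff (hlow.trans hr.le) (hrs.trans_le h1)).1 hr.le
    have hq : q ∈ Φ r' ⁻¹' interior M := by
      have := h.inward _ hr0 (r' - r) (by linarith)
      rwa [← h.add, sub_add_cancel] at this
    filter_upwards [(isOpen_interior.preimage (hΦ r')).mem_nhds hq] with p hp
    exact ((h.entryTime_le_iff (by linarith) (by linarith)).2
      (interior_subset hp)).trans_lt hrs'

theorem entryTime_flow (h : IsInwardFlow Φ M) {s : ℝ}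
    (h1 : entryTime Φ M B q ∈ Ioo (-B) B) (h2 : entryTime Φ M B q - s ∈ Ioo (-B) B) :
    entryTime Φ M B (Φ s q) = entryTime Φ M B q - s := by
  set a := entryTime Φ M B q with ha
  have hB : 0 ≤ B := by linarith [h1.1, h1.2]
  have hle : entryTime Φ M B (Φ s q) ≤ a - s := by
    rw [h.entryTime_le_iff h2.1.le h2.2, ← h.add, sub_add_cancel,
      ← h.entryTime_le_iff h1.1.le h1.2]
  refine le_antisymm hle ?_
  set b := entryTime Φ M B (Φ s q) with hb
  have hbB : -B ≤ b := (entryTime_mem hB).1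
  have hM : Φ (b + s) q ∈ M := by
    rw [h.add, ← h.entryTime_le_iff hbB (hle.trans_lt h2.2)]
  rcases le_or_gt (-B) (b + s) with h3 | h3
  · have := (h.entryTime_le_iff (B := B) h3 (by linarith [h1.2])).2 hM
    linarith
  · have := (h.entryTime_le_iff (B := B) (t := -B) le_rfl (by linarith [h1.1, h1.2])).2
      (h.mono h3.le hM)
    linarith [h1.1]

variable {N : Set X} {T : ℝ}

theorem entryTime_le_add (hM : IsInwardFlow Φ M) (hN : IsInwardFlow Φ N)
    (hMN : ∀ q ∈ M, Φ T q ∈ N) (h1 : -B ≤ entryTime Φ M B q + T)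
    (h2 : entryTime Φ M B q + T < B) (h3 : 0 < T) :
    entryTime Φ N B q ≤ entryTime Φ M B q + T := by
  have hB : 0 ≤ B := by linarith
  rw [hN.entryTime_le_iff h1 h2, add_comm, hN.add]
  refine hMN _ ?_
  rw [← hM.entryTime_le_iff (B := B) (entryTime_mem hB).1 (by linarith)]

/-- Two closed sets which are pushed into each other by a flow that carries both into their
interiors are identified by sliding along the orbits. -/
theorem exists_sliding (hM : IsInwardFlow Φ M) (hN : IsInwardFlow Φ N) (hT : 0 < T)
    (hMN : ∀ q ∈ M, Φ T q ∈ N) (hNM : ∀ q ∈ N, Φ T q ∈ M) :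
    ∃ τ : X → ℝ, Continuous τ ∧ InjOn (fun q => Φ (τ q) q) M ∧
      (fun q => Φ (τ q) q) '' M = N := by
  set a := entryTime Φ M (6 * T) with ha
  set b := entryTime Φ N (6 * T) with hb
  have hB : 0 ≤ 6 * T := by linarith
  have amem : ∀ q, a q ∈ Icc (-(6 * T)) (6 * T) := fun q => entryTime_mem hB
  have bmem : ∀ q, b q ∈ Icc (-(6 * T)) (6 * T) := fun q => entryTime_mem hB
  have aM : ∀ q, a q ≤ 0 ↔ q ∈ M := fun q => by
    rw [ha, hM.entryTime_le_iff (by linarith) (by linarith), hM.zero]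
  have bN : ∀ q, b q ≤ 0 ↔ q ∈ N := fun q => by
    rw [hb, hN.entryTime_le_iff (by linarith) (by linarith), hN.zero]
  have hab : ∀ q, a q < 5 * T → b q ≤ a q + T := fun q hq =>
    hM.entryTime_le_add hN hMN (by linarith [(amem q).1]) (by linarith) hT
  have hba : ∀ q, b q < 5 * T → a q ≤ b q + T := fun q hq =>
    hN.entryTime_le_add hM hNM (by linarith [(bmem q).1]) (by linarith) hT
  have ashift : ∀ q s, a q ∈ Ioo (-(6 * T)) (6 * T) → a q - s ∈ Ioo (-(6 * T)) (6 * T) →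
      a (Φ s q) = a q - s := fun q s h1 h2 => hM.entryTime_flow h1 h2
  have bshift : ∀ q s, b q ∈ Ioo (-(6 * T)) (6 * T) → b q - s ∈ Ioo (-(6 * T)) (6 * T) →
      b (Φ s q) = b q - s := fun q s h1 h2 => hN.entryTime_flow h1 h2
  set τ : X → ℝ := fun q => (b q - a q) * max 0 (1 + a q / (2 * T)) with hτ
  have ac : Continuous a := hM.continuous_entryTime hB
  have bc : Continuous b := hN.continuous_entryTime hB
  have τdeep : ∀ q, a q ≤ -(2 * T) → τ q = 0 := by
    intro q hq
    have : 1 + a q / (2 * T) ≤ 0 := by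
      have : a q / (2 * T) ≤ -1 := by rw [div_le_iff₀ (by linarith)]; linarith
      linarith
    simp [hτ, max_eq_left this]
  have τshallow : ∀ q, -(2 * T) ≤ a q → τ q = (b q - a q) * (1 + a q / (2 * T)) := by
    intro q hq
    have : 0 ≤ 1 + a q / (2 * T) := by
      have : -1 ≤ a q / (2 * T) := by rw [le_div_iff₀ (by linarith)]; linarith
      linarith
    simp [hτ, max_eq_right this]
  have deepN : ∀ q, a q ≤ -(2 * T) → q ∈ N := by
    intro q hq
    have h1 : Φ (-(2 * T)) q ∈ M :=
      (hM.entryTime_le_iff (B := 6 * T) (by linarith) (by linarith)).1 hq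
    have h2 := hMN _ h1
    rw [← hM.add] at h2
    have h3 := hN.mono (t := 0) (by linarith) h2
    rwa [hN.zero] at h3
  refine ⟨τ, by fun_prop, ?_, ?_⟩
  · have key : ∀ q ∈ M, ∀ s, 0 < s → s = τ q - τ (Φ s q) → False := by
      intro q hq s hs heq
      have haq := (aM q).2 hq
      rcases le_or_gt (a q) (-(2 * T)) with hdeep | hsh
      · have h1 : Φ (-(2 * T)) (Φ s q) ∈ M := by
          rw [← hM.add]
          exact hM.mono (by linarith)
            ((hM.entryTime_le_iff (B := 6 * T) (by linarith) (by linarith)).1 hdeep)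
        have h2 := (hM.entryTime_le_iff (B := 6 * T) (by linarith) (by linarith)).2 h1
        rw [τdeep _ hdeep, τdeep _ h2] at heq
        linarith
      · have h1 := hab q (by linarith)
        have h2 := hba q (by linarith)
        have hw : 0 ≤ 1 + a q / (2 * T) ∧ 1 + a q / (2 * T) ≤ 1 := by
          constructor
          · have : -1 ≤ a q / (2 * T) := by rw [le_div_iff₀ (by linarith)]; linarith
            linarith
          · have : a q / (2 * T) ≤ 0 := div_nonpos_of_nonpos_of_nonneg haq (by linarith)
            linarith
        by_cases hsT : s ≤ 2 * T
        · have ha' := ashift q s ⟨by linarith, by linarith⟩ ⟨by linarith, by linarith⟩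
          have hb' := bshift q s ⟨by linarith, by linarith⟩ ⟨by linarith, by linarith⟩
          have hlip : |max 0 (1 + a q / (2 * T)) - max 0 (1 + (a q - s) / (2 * T))|
              ≤ s / (2 * T) := by
            refine (abs_max_sub_max_le_max _ _ _ _).trans ?_
            have : 1 + a q / (2 * T) - (1 + (a q - s) / (2 * T)) = s / (2 * T) := by ring
            rw [this, sub_self, abs_zero, abs_of_pos (by positivity)]
            exact max_le (by positivity) le_rfl
          have hd : |b q - a q| ≤ T := abs_le.2 ⟨by linarith, by linarith⟩
          have : s ≤ T * (s / (2 * T)) := by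
            calc s = τ q - τ (Φ s q) := heq
              _ = (b q - a q) *
                  (max 0 (1 + a q / (2 * T)) - max 0 (1 + (a q - s) / (2 * T))) := by
                simp only [hτ, ha', hb']; ring
              _ ≤ |b q - a q| *
                  |max 0 (1 + a q / (2 * T)) - max 0 (1 + (a q - s) / (2 * T))| := by
                rw [← abs_mul]; exact le_abs_self _
              _ ≤ T * (s / (2 * T)) := by gcongr
          have h3 : T * (s / (2 * T)) = s / 2 := by field_simp
          linarith
        · have h1' : Φ (-(2 * T)) (Φ s q) ∈ M := by
            rw [← hM.add]
            exact hM.mono (s := 0) (by linarith) (by rwa [hM.zero])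
          have h2' := (hM.entryTime_le_iff (B := 6 * T) (by linarith) (by linarith)).2 h1'
          rw [τdeep _ h2', τshallow _ hsh.le] at heq
          nlinarith
    intro q hq q' hq' heq
    have heq : Φ (τ q) q = Φ (τ q') q' := heq
    have e1 : q' = Φ (τ q - τ q') q := by
      rw [sub_eq_neg_add, hM.add, heq, ← hM.add, neg_add_cancel, hM.zero]
    have e2 : q = Φ (τ q' - τ q) q' := by
      rw [sub_eq_neg_add, hM.add, ← heq, ← hM.add, neg_add_cancel, hM.zero]
    rcases lt_trichotomy (τ q - τ q') 0 with h | h | h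
    · exact (key q' hq' (τ q' - τ q) (by linarith) (by rw [← e2])).elim
    · rw [e1, h, hM.zero]
    · exact (key q hq (τ q - τ q') h (by rw [← e1])).elim
  · apply Subset.antisymm
    · rintro _ ⟨q, hq, rfl⟩
      have haq := (aM q).2 hq
      change Φ (τ q) q ∈ N
      rcases le_or_gt (a q) (-(2 * T)) with hdeep | hsh
      · rw [τdeep _ hdeep, hN.zero]
        exact deepN q hdeep
      · have h1 := hab q (by linarith)
        have h2 := hba q (by linarith)
        have hτq : τ q = b q - a q + (b q - a q) * a q / (2 * T) := by
          rw [τshallow _ hsh.le]; ring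
        have h3 : |(b q - a q) * a q / (2 * T)| ≤ -a q / 2 := by
          rw [abs_div, abs_mul, abs_of_nonpos haq, abs_of_pos (by linarith : 0 < 2 * T),
            div_le_iff₀ (by linarith)]
          have : |b q - a q| ≤ T := abs_le.2 ⟨by linarith, by linarith⟩
          nlinarith
        have h4 := abs_le.1 h3
        rw [← hN.entryTime_le_iff (B := 6 * T) (by linarith) (by linarith)]
        change b q ≤ τ q
        linarith
    · intro p hp
      have hbp := (bN p).2 hp
      rcases le_or_gt (a p) (-(2 * T)) with hdeep | hsh
      · exact ⟨p, (aM p).1 (by linarith), by simp only [τdeep _ hdeep, hM.zero]⟩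
      · have h1 := hba p (by linarith)
        have h2 := hab p (by linarith)
        set δ := b p - a p with hδ
        have hpos : 0 < 2 * T - δ := by linarith
        -- the point of `M` slid onto `p` lies at time `-σ` from `p`
        set σ := δ * (a p + 2 * T) / (2 * T - δ) with hσ
        have hσδ : σ * (2 * T - δ) = δ * (a p + 2 * T) := by
          rw [hσ]; field_simp
        have hσ' : a p + σ = 2 * T * b p / (2 * T - δ) := by
          rw [eq_div_iff hpos.ne', add_mul, hσδ]
          have : b p = a p + δ := by rw [hδ]; ring
          rw [this]; ring
        have hle : a p + σ ≤ 0 := by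
          rw [hσ']
          exact div_nonpos_of_nonpos_of_nonneg (by nlinarith) hpos.le
        have hge : -(2 * T) ≤ a p + σ := by
          rw [hσ', le_div_iff₀ hpos]
          have : b p = a p + δ := by rw [hδ]; ring
          rw [this]
          nlinarith
        have ha' : a (Φ (-σ) p) = a p + σ := by
          rw [ashift p (-σ) ⟨by linarith, by linarith⟩ ⟨by linarith, by linarith⟩]; ring
        have hb' : b (Φ (-σ) p) = b p + σ := by
          rw [bshift p (-σ) ⟨by linarith, by linarith⟩ ⟨by linarith, by linarith⟩]; ring
        refine ⟨Φ (-σ) p, (aM _).1 (by rw [ha']; exact hle), ?_⟩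
        have hτσ : τ (Φ (-σ) p) = σ := by
          rw [τshallow _ (by rw [ha']; exact hge), ha', hb', add_sub_add_right_eq_sub, ← hδ]
          have hT2 : (2 * T) ≠ 0 := by linarith
          have : δ * (2 * T + (a p + σ)) = σ * (2 * T) := by linarith
          calc δ * (1 + (a p + σ) / (2 * T)) = δ * (2 * T + (a p + σ)) / (2 * T) := by
                field_simp
            _ = σ := by rw [this]; field_simp
        change Φ (τ (Φ (-σ) p)) (Φ (-σ) p) = p
        rw [hτσ, ← hM.add, add_neg_cancel, hM.zero]

end IsInwardFlow

end Flow

section LatticeFlow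

/-- The flow on `[-1, 1]` with repelling fixed point `0` and attracting fixed points `±1`. -/
noncomputable def spread (t y : ℝ) : ℝ := y / √(y ^ 2 + Real.exp (-t) * (1 - y ^ 2))

theorem spread_denom_pos {t y : ℝ} (hy : y ∈ Icc (-1 : ℝ) 1) :
    0 < y ^ 2 + Real.exp (-t) * (1 - y ^ 2) := by
  have he := Real.exp_pos (-t)
  have h1 : y ^ 2 ≤ 1 := by nlinarith [hy.1, hy.2]
  rcases h1.lt_or_eq with h | h
  · have : 0 < Real.exp (-t) * (1 - y ^ 2) := mul_pos he (by linarith)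
    nlinarith [sq_nonneg y]
  · rw [h]; norm_num

theorem spread_sq {t y : ℝ} (hy : y ∈ Icc (-1 : ℝ) 1) :
    spread t y ^ 2 = y ^ 2 / (y ^ 2 + Real.exp (-t) * (1 - y ^ 2)) := by
  rw [spread, div_pow, Real.sq_sqrt (spread_denom_pos hy).le]

theorem spread_mem {t y : ℝ} (hy : y ∈ Icc (-1 : ℝ) 1) : spread t y ∈ Icc (-1 : ℝ) 1 := by
  refine abs_le.1 ((sq_le_one_iff_abs_le_one _).1 ?_)
  rw [spread_sq hy, div_le_one (spread_denom_pos hy)]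
  have h1 : y ^ 2 ≤ 1 := by nlinarith [hy.1, hy.2]
  have := mul_nonneg (Real.exp_pos (-t)).le (sub_nonneg.2 h1)
  linarith

theorem spread_one (t : ℝ) : spread t 1 = 1 := by simp [spread]

theorem spread_neg (t y : ℝ) : spread t (-y) = -spread t y := by simp [spread, neg_div]

theorem spread_zero {y : ℝ} : spread 0 y = y := by simp [spread]

theorem spread_add {s t y : ℝ} (hy : y ∈ Icc (-1 : ℝ) 1) :
    spread (s + t) y = spread s (spread t y) := by
  have hd := spread_denom_pos (t := t) hy
  have h2 : spread t y ^ 2 + Real.exp (-s) * (1 - spread t y ^ 2) =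
      (y ^ 2 + Real.exp (-(s + t)) * (1 - y ^ 2)) /
        (y ^ 2 + Real.exp (-t) * (1 - y ^ 2)) := by
    rw [spread_sq hy, neg_add, Real.exp_add]
    field_simp
    ring
  rw [spread, spread, h2, Real.sqrt_div' _ hd.le, spread, div_div_div_cancel_right₀]
  exact (Real.sqrt_pos.2 hd).ne'

theorem lt_spread {t y : ℝ} (ht : 0 < t) (hy : y ∈ Ioo (0 : ℝ) 1) : y < spread t y := by
  have hd := spread_denom_pos (t := t) (y := y) ⟨by linarith [hy.1], hy.2.le⟩
  have he : Real.exp (-t) < 1 := Real.exp_lt_one_iff.2 (by linarith)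
  rw [spread, lt_div_iff₀ (Real.sqrt_pos.2 hd)]
  have h1 : √(y ^ 2 + Real.exp (-t) * (1 - y ^ 2)) < 1 := by
    have h : 0 < 1 - y ^ 2 := by nlinarith [hy.1, hy.2]
    rw [Real.sqrt_lt' one_pos]
    linarith [mul_pos (sub_pos.2 he) h]
  nlinarith [hy.1]

theorem tendsto_spread {y : ℝ} (hy : 0 < y) : Tendsto (fun t => spread t y) atTop (𝓝 1) := by
  have h1 : Tendsto (fun t : ℝ => Real.exp (-t)) atTop (𝓝 0) :=
    Real.tendsto_exp_neg_atTop_nhds_zero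
  have h2 : Tendsto (fun t => spread t y) atTop (𝓝 (y / √(y ^ 2 + 0 * (1 - y ^ 2)))) :=
    tendsto_const_nhds.div ((h1.mul_const _).const_add _).sqrt
      (by simp [Real.sqrt_sq hy.le, hy.ne'])
  simpa [Real.sqrt_sq hy.le, hy.ne'] using h2

theorem continuousOn_spread :
    ContinuousOn (fun p : ℝ × ℝ => spread p.1 p.2) (univ ×ˢ Icc (-1) 1) := by
  refine ContinuousOn.div (by fun_prop) (by fun_prop) fun p hp => ?_
  exact (Real.sqrt_pos.2 (spread_denom_pos hp.2)).ne'

/-- The periodic flow on `ℝ` attracting to the integers and repelling from the half-integers. -/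
noncomputable def latticeFlow (t s : ℝ) : ℝ :=
  s + ((1 + spread t (2 * Int.fract s - 1)) / 2 - Int.fract s)

theorem latticeFlow_int_add (t : ℝ) (n : ℤ) {x : ℝ} (hx : x ∈ Icc (0 : ℝ) 1) :
    latticeFlow t (n + x) = n + (1 + spread t (2 * x - 1)) / 2 := by
  rcases hx.2.lt_or_eq with h | rfl
  · have : Int.fract ((n : ℝ) + x) = x := by
      rw [Int.fract_intCast_add, Int.fract_eq_self.2 ⟨hx.1, h⟩]
    rw [latticeFlow, this]; ring
  · have : Int.fract ((n : ℝ) + 1) = 0 := by simp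
    rw [latticeFlow, this]
    have h1 : spread t (2 * 0 - 1) = -1 := by
      rw [show (2 * 0 - 1 : ℝ) = -1 by norm_num, spread_neg, spread_one]
    rw [h1, show (2 * 1 - 1 : ℝ) = 1 by norm_num, spread_one]
    ring

theorem exists_int_add (s : ℝ) : ∃ (n : ℤ) (x : ℝ), x ∈ Icc (0 : ℝ) 1 ∧ s = n + x :=
  ⟨⌊s⌋, Int.fract s, ⟨Int.fract_nonneg s, (Int.fract_lt_one s).le⟩,
    (Int.floor_add_fract s).symm⟩

theorem two_mul_sub_one_mem {x : ℝ} (hx : x ∈ Icc (0 : ℝ) 1) : 2 * x - 1 ∈ Icc (-1 : ℝ) 1 :=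
  ⟨by linarith [hx.1], by linarith [hx.2]⟩

theorem latticeFlow_zero (s : ℝ) : latticeFlow 0 s = s := by
  simp only [latticeFlow, spread_zero]; ring

theorem latticeFlow_add (r t s : ℝ) : latticeFlow (r + t) s = latticeFlow r (latticeFlow t s) := by
  obtain ⟨n, x, hx, rfl⟩ := exists_int_add s
  have hy := two_mul_sub_one_mem hx
  have hm := spread_mem (t := t) hy
  rw [latticeFlow_int_add _ _ hx, latticeFlow_int_add _ _ hx, latticeFlow_int_add, spread_add hy]
  · congr 4; ring
  · exact ⟨by linarith [hm.1], by linarith [hm.2]⟩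

theorem continuous_latticeFlow : Continuous fun p : ℝ × ℝ => latticeFlow p.1 p.2 := by
  have h : ContinuousOn (Function.uncurry fun t x : ℝ => (1 + spread t (2 * x - 1)) / 2 - x)
      (univ ×ˢ Icc 0 1) := by
    have h1 : ContinuousOn (fun p : ℝ × ℝ => spread p.1 (2 * p.2 - 1)) (univ ×ˢ Icc 0 1) :=
      continuousOn_spread.comp (f := fun p : ℝ × ℝ => (p.1, 2 * p.2 - 1)) (by fun_prop)
        fun p hp => ⟨trivial, two_mul_sub_one_mem hp.2⟩
    exact ((continuousOn_const.add h1).div_const 2).sub continuousOn_snd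
  have h2 := h.comp_fract' fun t => by
    have h1 : spread t (2 * 0 - 1) = -1 := by
      rw [show (2 * 0 - 1 : ℝ) = -1 by norm_num, spread_neg, spread_one]
    rw [h1, show (2 * 1 - 1 : ℝ) = 1 by norm_num, spread_one]
    norm_num
  exact continuous_snd.add h2

theorem latticeFlow_mem_Icc {t s : ℝ} {n : ℤ} (hs : s ∈ Icc (n : ℝ) (n + 1)) :
    latticeFlow t s ∈ Icc (n : ℝ) (n + 1) := by
  have hx : s - n ∈ Icc (0 : ℝ) 1 := ⟨by linarith [hs.1], by linarith [hs.2]⟩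
  have hm := spread_mem (t := t) (two_mul_sub_one_mem hx)
  rw [show s = n + (s - n) by ring, latticeFlow_int_add t n hx]
  exact ⟨by linarith [hm.1], by linarith [hm.2]⟩

theorem latticeFlow_nonneg {t s : ℝ} (hs : 0 ≤ s) : 0 ≤ latticeFlow t s := by
  have h := (latticeFlow_mem_Icc (t := t) (n := ⌊s⌋)
    ⟨Int.floor_le s, (Int.lt_floor_add_one s).le⟩).1
  have : (0 : ℝ) ≤ ⌊s⌋ := by exact_mod_cast Int.floor_nonneg.2 hs
  linarith

/-- The distance from `s` to the interval `[m, m + 1]`. -/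
noncomputable def intervalDist (m : ℤ) (s : ℝ) : ℝ := max 0 (max (m - s) (s - m - 1))

theorem intervalDist_nonneg (m : ℤ) (s : ℝ) : 0 ≤ intervalDist m s := le_max_left _ _

theorem continuous_intervalDist (m : ℤ) : Continuous (intervalDist m) := by
  unfold intervalDist
  fun_prop

theorem intervalDist_le_iff {m : ℤ} {s r : ℝ} (hr : 0 ≤ r) :
    intervalDist m s ≤ r ↔ s ∈ Icc (m - r) (m + 1 + r) := by
  simp only [intervalDist, max_le_iff, hr, true_and, mem_Icc]
  constructor <;> rintro ⟨h1, h2⟩ <;> constructor <;> linarith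

theorem intervalDist_lt_iff {m : ℤ} {s r : ℝ} (hr : 0 < r) :
    intervalDist m s < r ↔ s ∈ Ioo (m - r) (m + 1 + r) := by
  simp only [intervalDist, max_lt_iff, hr, true_and, mem_Ioo]
  constructor <;> rintro ⟨h1, h2⟩ <;> constructor <;> linarith

theorem intervalDist_of_mem {m : ℤ} {s : ℝ} (hs : s ∈ Icc (m : ℝ) (m + 1)) :
    intervalDist m s = 0 :=
  le_antisymm ((intervalDist_le_iff le_rfl).2 (by simpa using hs)) (intervalDist_nonneg m s)

/-- Near `[m, m + 1]`, a point outside the interval lies to the left or to the right of it, at the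
same distance from the nearest integer. -/
theorem intervalDist_cases {m : ℤ} {s : ℝ} (h0 : 0 < intervalDist m s)
    (h1 : intervalDist m s < 1 / 2) :
    (s = m - intervalDist m s) ∨ (s = m + 1 + intervalDist m s) := by
  have h2 := (intervalDist_lt_iff (by norm_num)).1 h1
  have hn : ¬ s ∈ Icc (m : ℝ) (m + 1) := fun hs => h0.ne' (intervalDist_of_mem hs)
  rcases lt_or_ge s m with h | h
  · left
    rw [intervalDist, max_eq_left (a := (m : ℝ) - s) (by linarith),
      max_eq_right (by linarith)]
    ring
  · right
    have h3 : (m : ℝ) + 1 < s := not_le.1 fun h' => hn ⟨h, h'⟩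
    rw [intervalDist, max_eq_right (a := (m : ℝ) - s) (by linarith),
      max_eq_right (by linarith)]
    ring

theorem latticeFlow_left (t : ℝ) (m : ℤ) {r : ℝ} (hr : r ∈ Icc (0 : ℝ) 1) :
    latticeFlow t (m - r) = m - (1 - spread t (1 - 2 * r)) / 2 := by
  have h := latticeFlow_int_add t (m - 1) (x := 1 - r) ⟨by linarith [hr.2], by linarith [hr.1]⟩
  push_cast at h
  rw [show (m : ℝ) - r = m - 1 + (1 - r) by ring, h,
    show 2 * (1 - r) - 1 = 1 - 2 * r by ring]
  ring

theorem latticeFlow_right (t : ℝ) (m : ℤ) {r : ℝ} (hr : r ∈ Icc (0 : ℝ) 1) :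
    latticeFlow t (m + 1 + r) = m + 1 + (1 - spread t (1 - 2 * r)) / 2 := by
  have h := latticeFlow_int_add t (m + 1) hr
  push_cast at h
  rw [h, show 2 * r - 1 = -(1 - 2 * r) by ring, spread_neg]
  ring

theorem intervalDist_latticeFlow (t : ℝ) {m : ℤ} {s : ℝ} (h0 : 0 < intervalDist m s)
    (h1 : intervalDist m s < 1 / 2) :
    intervalDist m (latticeFlow t s) = (1 - spread t (1 - 2 * intervalDist m s)) / 2 := by
  set r := intervalDist m s with hr
  have hr' : r ∈ Icc (0 : ℝ) 1 := ⟨h0.le, by linarith⟩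
  have hm := spread_mem (t := t) (y := 1 - 2 * r) ⟨by linarith, by linarith⟩
  rcases intervalDist_cases h0 h1 with h | h
  · rw [h, ← hr, latticeFlow_left t m hr', intervalDist, max_eq_left (b := _ - 1),
      max_eq_right] <;> linarith [hm.1, hm.2]
  · rw [h, ← hr, latticeFlow_right t m hr', intervalDist, max_eq_right (a := _ - _),
      max_eq_right] <;> linarith [hm.1, hm.2]

theorem intervalDist_latticeFlow_lt {t : ℝ} (ht : 0 < t) {m : ℤ} {s : ℝ}
    (h0 : 0 < intervalDist m s) (h1 : intervalDist m s < 1 / 2) :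
    intervalDist m (latticeFlow t s) < intervalDist m s := by
  rw [intervalDist_latticeFlow t h0 h1]
  have := lt_spread ht (y := 1 - 2 * intervalDist m s) ⟨by linarith, by linarith⟩
  linarith

theorem intervalDist_latticeFlow_of_eq_zero (t : ℝ) {m : ℤ} {s : ℝ} (h : intervalDist m s = 0) :
    intervalDist m (latticeFlow t s) = 0 := by
  refine intervalDist_of_mem (latticeFlow_mem_Icc ?_)
  simpa using (intervalDist_le_iff le_rfl).1 h.le

theorem intervalDist_latticeFlow_le {t : ℝ} (ht : 0 < t) {m : ℤ} {s : ℝ}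
    (h1 : intervalDist m s < 1 / 2) :
    intervalDist m (latticeFlow t s) ≤ intervalDist m s := by
  rcases (intervalDist_nonneg m s).lt_or_eq with h | h
  · exact (intervalDist_latticeFlow_lt ht h h1).le
  · rw [intervalDist_latticeFlow_of_eq_zero t h.symm, ← h]

theorem tendsto_intervalDist_latticeFlow {m : ℤ} {s : ℝ} (h1 : intervalDist m s < 1 / 2) :
    Tendsto (fun t => intervalDist m (latticeFlow t s)) atTop (𝓝 0) := by
  rcases (intervalDist_nonneg m s).lt_or_eq with h | h
  · simp only [intervalDist_latticeFlow _ h h1]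
    have := ((tendsto_spread (y := 1 - 2 * intervalDist m s) (by linarith)).const_sub 1).div_const 2
    simpa using this
  · simp only [intervalDist_latticeFlow_of_eq_zero _ h.symm, tendsto_const_nhds]

end LatticeFlow

theorem IsInwardFlow.exists_forall_mem {X : Type*} [TopologicalSpace X] {Φ : ℝ → X → X}
    {K N : Set X} (hN : IsInwardFlow Φ N) (hK : IsCompact K) (h : ∀ q ∈ K, ∃ t, Φ t q ∈ N) :
    ∃ T, ∀ t, T ≤ t → ∀ q ∈ K, Φ t q ∈ N := by
  have hinc : ∀ s t q, s ≤ t → Φ s q ∈ interior N → Φ t q ∈ interior N := by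
    intro s t q hst hs
    rcases hst.eq_or_lt with rfl | hlt
    · exact hs
    · simpa [← hN.add] using hN.inward _ (interior_subset hs) (t - s) (sub_pos.2 hlt)
  obtain ⟨T, hT⟩ := hK.elim_directed_cover (fun t : ℝ => {q | Φ t q ∈ interior N})
    (fun t => isOpen_interior.preimage (hN.continuous.comp (continuous_const.prodMk continuous_id)))
    (fun q hq => by
      obtain ⟨t, ht⟩ := h q hq
      refine mem_iUnion.2 ⟨1 + t, ?_⟩
      change Φ (1 + t) q ∈ interior N
      rw [hN.add]
      exact hN.inward _ ht 1 one_pos)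
    (fun s t => ⟨max s t, fun q hq => hinc _ _ _ (le_max_left _ _) hq,
      fun q hq => hinc _ _ _ (le_max_right _ _) hq⟩)
  exact ⟨T, fun t ht q hq => interior_subset (hinc _ _ _ ht (hT hq))⟩

namespace expNegInvGlue

theorem hasDerivAt (x : ℝ) : HasDerivAt expNegInvGlue (deriv expNegInvGlue x) x :=
  ((expNegInvGlue.contDiff (n := 1)).differentiable (by simp) x).hasDerivAt

theorem deriv_of_nonpos {x : ℝ} (hx : x ≤ 0) : deriv expNegInvGlue x = 0 := by
  refine IsLocalMin.deriv_eq_zero (Eventually.of_forall fun y => ?_)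
  rw [zero_of_nonpos hx]
  exact expNegInvGlue.nonneg y

theorem deriv_pos {x : ℝ} (hx : 0 < x) : 0 < deriv expNegInvGlue x := by
  have h1 : HasDerivAt (fun y : ℝ => Real.exp (-y⁻¹)) (Real.exp (-x⁻¹) * -(-(x ^ 2)⁻¹)) x :=
    (hasDerivAt_inv hx.ne').neg.exp
  have h2 : expNegInvGlue =ᶠ[𝓝 x] fun y => Real.exp (-y⁻¹) := by
    filter_upwards [lt_mem_nhds hx] with y hy
    simp [expNegInvGlue, not_le.2 hy]
  rw [h2.deriv_eq, h1.deriv]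
  have := Real.exp_pos (-x⁻¹)
  simp only [neg_neg]
  positivity

theorem deriv_nonneg (x : ℝ) : 0 ≤ deriv expNegInvGlue x := by
  rcases le_or_gt x 0 with h | h
  · exact (deriv_of_nonpos h).ge
  · exact (deriv_pos h).le

theorem lt_of_lt {x y : ℝ} (hx : 0 ≤ x) (hxy : x < y) : expNegInvGlue x < expNegInvGlue y := by
  have hc : Continuous expNegInvGlue := (expNegInvGlue.contDiff (n := 0)).continuous
  exact strictMonoOn_of_deriv_pos (convex_Ici (0 : ℝ)) hc.continuousOn
    (fun z hz => deriv_pos (by simpa using hz)) hx (hx.trans hxy.le : (0 : ℝ) ≤ y) hxy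

end expNegInvGlue

section Cubes

variable {d : ℕ}

/-- The closed `r`-neighbourhood of the union of the unit cubes with lower corners in `A`. -/
def cubeHull (A : Finset (Fin d → ℤ)) (r : ℝ) : Set (Fin d → ℝ) :=
  {q | ∃ m ∈ A, ∀ i, intervalDist (m i) (q i) ≤ r}

theorem isCompact_cubeHull (A : Finset (Fin d → ℤ)) {r : ℝ} (hr : 0 ≤ r) :
    IsCompact (cubeHull A r) := by
  have : cubeHull A r = ⋃ m ∈ A, univ.pi fun i => Icc ((m i : ℝ) - r) (m i + 1 + r) := by
    ext q
    simp only [cubeHull, intervalDist_le_iff hr, mem_ofPred_eq, mem_iUnion, mem_univ_pi,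
      exists_prop]
  rw [this]
  exact A.isCompact_biUnion fun m _ => isCompact_univ_pi fun i => isCompact_Icc

theorem continuous_intervalDist_apply (m : Fin d → ℤ) (i : Fin d) :
    Continuous fun q : Fin d → ℝ => intervalDist (m i) (q i) :=
  (continuous_intervalDist _).comp (continuous_apply i)

/-- The penalty for leaving the interval `[m, m + 1]`. -/
noncomputable def intervalPenalty (m : ℤ) (s : ℝ) : ℝ := expNegInvGlue (intervalDist m s)

theorem intervalPenalty_nonneg (m : ℤ) (s : ℝ) : 0 ≤ intervalPenalty m s :=
  expNegInvGlue.nonneg _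

theorem intervalPenalty_eq (m : ℤ) :
    intervalPenalty m = fun s => expNegInvGlue (m - s) + expNegInvGlue (s - m - 1) := by
  funext s
  rcases le_or_gt s m with h | h
  · rw [intervalPenalty, intervalDist, max_eq_left (a := (m : ℝ) - s) (by linarith),
      max_eq_right (by linarith), expNegInvGlue.zero_of_nonpos (x := s - m - 1) (by linarith),
      add_zero]
  · rw [expNegInvGlue.zero_of_nonpos (x := m - s) (by linarith), zero_add, intervalPenalty]
    rcases le_or_gt s (m + 1) with h' | h'
    · rw [intervalDist_of_mem ⟨h.le, h'⟩, expNegInvGlue.zero,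
        expNegInvGlue.zero_of_nonpos (by linarith)]
    · rw [intervalDist, max_eq_right (a := (m : ℝ) - s) (by linarith),
        max_eq_right (by linarith)]

theorem contDiff_intervalPenalty (m : ℤ) : ContDiff ℝ ∞ (intervalPenalty m) := by
  rw [intervalPenalty_eq]
  have hE : ContDiff ℝ ∞ expNegInvGlue := expNegInvGlue.contDiff
  exact (hE.comp (contDiff_const.sub contDiff_id)).add
    (hE.comp ((contDiff_id.sub contDiff_const).sub contDiff_const))

theorem hasDerivAt_intervalPenalty (m : ℤ) (s : ℝ) :
    HasDerivAt (intervalPenalty m)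
      (deriv expNegInvGlue (s - m - 1) - deriv expNegInvGlue (m - s)) s := by
  rw [intervalPenalty_eq]
  have h1 := (expNegInvGlue.hasDerivAt (m - s)).comp s ((hasDerivAt_id s).const_sub (m : ℝ))
  have h2 := (expNegInvGlue.hasDerivAt (s - m - 1)).comp s
    (((hasDerivAt_id s).sub_const (m : ℝ)).sub_const 1)
  exact (h1.add h2).congr_deriv (by ring)

/-- The argument of `cubeBump`. -/
noncomputable def cubeLevel (m : Fin d → ℤ) (q : Fin d → ℝ) : ℝ :=
  expNegInvGlue (1 / 2) - ∑ i, intervalPenalty (m i) (q i)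

/-- A smooth bump function around the unit cube with lower corner `m`. -/
noncomputable def cubeBump (m : Fin d → ℤ) (q : Fin d → ℝ) : ℝ := expNegInvGlue (cubeLevel m q)

theorem cubeBump_nonneg (m : Fin d → ℤ) (q : Fin d → ℝ) : 0 ≤ cubeBump m q :=
  expNegInvGlue.nonneg _

theorem intervalDist_lt_half {m : Fin d → ℤ} {q : Fin d → ℝ} (h : 0 < cubeLevel m q)
    (i : Fin d) : intervalDist (m i) (q i) < 1 / 2 := by
  by_contra! hi
  have h1 : expNegInvGlue (1 / 2) ≤ intervalPenalty (m i) (q i) := expNegInvGlue.monotone hi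
  have h2 := Finset.single_le_sum (f := fun i => intervalPenalty (m i) (q i))
    (fun i _ => intervalPenalty_nonneg _ _) (Finset.mem_univ i)
  simp only [cubeLevel] at h
  linarith

theorem contDiff_cubeLevel (m : Fin d → ℤ) : ContDiff ℝ ∞ (cubeLevel m) :=
  contDiff_const.sub (ContDiff.sum fun i _ =>
    (contDiff_intervalPenalty (m i)).comp (contDiff_apply ℝ ℝ i))

theorem contDiff_cubeBump (m : Fin d → ℤ) : ContDiff ℝ ∞ (cubeBump m) :=
  expNegInvGlue.contDiff.comp (contDiff_cubeLevel m)

theorem fderiv_cubeBump_single (m : Fin d → ℤ) (p : Fin d → ℝ) (i : Fin d) :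
    fderiv ℝ (cubeBump m) p (Pi.single i 1) = deriv expNegInvGlue (cubeLevel m p) *
      (deriv expNegInvGlue (m i - p i) - deriv expNegInvGlue (p i - m i - 1)) := by
  have h1 : HasFDerivAt (fun q : Fin d → ℝ => ∑ j, intervalPenalty (m j) (q j))
      (∑ j, (deriv expNegInvGlue (p j - m j - 1) - deriv expNegInvGlue (m j - p j)) •
        ContinuousLinearMap.proj (R := ℝ) (φ := fun _ : Fin d => ℝ) j) p :=
    HasFDerivAt.fun_sum fun j _ =>
      (hasDerivAt_intervalPenalty (m j) (p j)).comp_hasFDerivAt (f := fun q : Fin d → ℝ => q j) p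
        (hasFDerivAt_apply j p)
  have h2 := (expNegInvGlue.hasDerivAt (cubeLevel m p)).comp_hasFDerivAt p (h1.const_sub _)
  change HasFDerivAt (cubeBump m) _ p at h2
  rw [h2.fderiv]
  simp only [smul_apply, neg_apply, _root_.sum_apply, ContinuousLinearMap.proj_apply,
    Pi.single_apply, smul_eq_mul, mul_ite, mul_one, mul_zero, Finset.sum_ite_eq',
    Finset.mem_univ, if_true]
  ring

/-- A smooth function which is positive on the union of the unit cubes with lower corners in `A`
and negative away from it. -/
noncomputable def cubeSmoothing (A : Finset (Fin d → ℤ)) (q : Fin d → ℝ) : ℝ :=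
  ∑ m ∈ A, cubeBump m q - expNegInvGlue (expNegInvGlue (1 / 2)) / 2

theorem bump_height_pos : 0 < expNegInvGlue (expNegInvGlue (1 / 2)) :=
  expNegInvGlue.pos_of_pos (expNegInvGlue.pos_of_pos (by norm_num))

theorem contDiff_cubeSmoothing (A : Finset (Fin d → ℤ)) : ContDiff ℝ ∞ (cubeSmoothing A) :=
  (ContDiff.sum fun m _ => contDiff_cubeBump m).sub contDiff_const

theorem exists_cubeLevel_pos {A : Finset (Fin d → ℤ)} {q : Fin d → ℝ}
    (h : 0 ≤ cubeSmoothing A q) : ∃ m ∈ A, 0 < cubeLevel m q := by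
  by_contra! h'
  have : ∑ m ∈ A, cubeBump m q = 0 :=
    Finset.sum_eq_zero fun m hm => expNegInvGlue.zero_of_nonpos (h' m hm)
  have := bump_height_pos
  simp only [cubeSmoothing] at h
  linarith

theorem cubeSmoothing_lower {A : Finset (Fin d → ℤ)} {m : Fin d → ℤ} (hm : m ∈ A)
    (q : Fin d → ℝ) :
    cubeBump m q - expNegInvGlue (expNegInvGlue (1 / 2)) / 2 ≤ cubeSmoothing A q :=
  sub_le_sub_right (Finset.single_le_sum (f := fun m => cubeBump m q)
    (fun m _ => cubeBump_nonneg m q) hm) _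

theorem cubeBump_of_forall_eq_zero {m : Fin d → ℤ} {q : Fin d → ℝ}
    (h : ∀ i, intervalDist (m i) (q i) = 0) :
    cubeBump m q = expNegInvGlue (expNegInvGlue (1 / 2)) := by
  simp [cubeBump, cubeLevel, intervalPenalty, h]

/-- The boundary of the smoothing is transverse to the faces of `ℝ^d_+`. -/
theorem exists_fderiv_cubeSmoothing_ne_zero {A : Finset (Fin d → ℤ)} {p : Fin d → ℝ}
    (hp : p ∈ Rplus d) (h : cubeSmoothing A p = 0) :
    ∃ i, 0 < p i ∧ fderiv ℝ (cubeSmoothing A) p (Pi.single i 1) ≠ 0 := by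
  obtain ⟨m₀, hm₀, hpos⟩ := exists_cubeLevel_pos h.ge
  have hex : ∃ i, intervalDist (m₀ i) (p i) ≠ 0 := by
    by_contra! h0
    have h1 := cubeSmoothing_lower hm₀ p
    rw [cubeBump_of_forall_eq_zero h0, h] at h1
    linarith [bump_height_pos]
  obtain ⟨i, hi⟩ := hex
  have hi0 := lt_of_le_of_ne (intervalDist_nonneg _ _) hi.symm
  have hcases := intervalDist_cases hi0 (intervalDist_lt_half hpos i)
  have hlt := intervalDist_lt_half hpos i
  have hbound : ∀ m : Fin d → ℤ, 0 < cubeLevel m p →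
      p i ∈ Ioo (m i - 1 / 2 : ℝ) (m i + 1 + 1 / 2) :=
    fun m hm => (intervalDist_lt_iff (by norm_num)).1 (intervalDist_lt_half hm i)
  set r := intervalDist (m₀ i) (p i)
  refine ⟨i, lt_of_le_of_ne (hp i) fun h0 => ?_, ?_⟩
  · rw [← h0] at hcases
    rcases hcases with h1 | h1
    · have h2 : (0 : ℝ) < m₀ i := by linarith
      have h3 : (m₀ i : ℝ) < 1 := by linarith
      norm_cast at h2 h3
      omega
    · have h2 : (m₀ i : ℝ) + 1 < 0 := by linarith
      have h3 : (-1 : ℝ) < m₀ i + 1 := by linarith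
      norm_cast at h2 h3
      omega
  have hsum : fderiv ℝ (cubeSmoothing A) p (Pi.single i 1) =
      ∑ m ∈ A, deriv expNegInvGlue (cubeLevel m p) *
        (deriv expNegInvGlue (m i - p i) - deriv expNegInvGlue (p i - m i - 1)) := by
    have h1 : HasFDerivAt (cubeSmoothing A) (∑ m ∈ A, fderiv ℝ (cubeBump m) p) p :=
      (HasFDerivAt.fun_sum fun m _ =>
        ((contDiff_cubeBump m).differentiable (by simp) p).hasFDerivAt).sub_const _
    simp only [h1.fderiv, _root_.sum_apply, fderiv_cubeBump_single]
  have hE0 := expNegInvGlue.deriv_pos hpos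
  rw [hsum]
  rcases hcases with h1 | h1
  · refine (Finset.sum_pos' (fun m _ => ?_) ⟨m₀, hm₀, ?_⟩).ne'
    · rcases le_or_gt (cubeLevel m p) 0 with hm | hm
      · rw [expNegInvGlue.deriv_of_nonpos hm, zero_mul]
      · have h2 : m₀ i - 2 < m i := by
          have h3 : (m₀ i : ℝ) - 2 < m i := by linarith [(hbound m hm).2]
          exact_mod_cast h3
        have h3 : (m₀ i : ℝ) ≤ m i + 1 := by exact_mod_cast (by omega : m₀ i ≤ m i + 1)
        rw [expNegInvGlue.deriv_of_nonpos (x := p i - m i - 1) (by linarith), sub_zero]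
        exact mul_nonneg (expNegInvGlue.deriv_nonneg _) (expNegInvGlue.deriv_nonneg _)
    · rw [expNegInvGlue.deriv_of_nonpos (x := p i - m₀ i - 1) (by linarith), sub_zero]
      exact mul_pos hE0 (expNegInvGlue.deriv_pos (by linarith))
  · refine (Finset.sum_neg' (fun m _ => ?_) ⟨m₀, hm₀, ?_⟩).ne
    · rcases le_or_gt (cubeLevel m p) 0 with hm | hm
      · rw [expNegInvGlue.deriv_of_nonpos hm, zero_mul]
      · have h2 : m i < m₀ i + 2 := by
          have h3 : (m i : ℝ) < m₀ i + 2 := by linarith [(hbound m hm).1]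
          exact_mod_cast h3
        have h3 : (m i : ℝ) ≤ m₀ i + 1 := by exact_mod_cast (by omega : m i ≤ m₀ i + 1)
        rw [expNegInvGlue.deriv_of_nonpos (x := m i - p i) (by linarith), zero_sub]
        exact mul_nonpos_of_nonneg_of_nonpos (expNegInvGlue.deriv_nonneg _)
          (neg_nonpos.2 (expNegInvGlue.deriv_nonneg _))
    · rw [expNegInvGlue.deriv_of_nonpos (x := m₀ i - p i) (by linarith), zero_sub]
      exact mul_neg_of_pos_of_neg hE0 (neg_lt_zero.2 (expNegInvGlue.deriv_pos (by linarith)))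

/-- The product of the flows `latticeFlow` on `ℝ^d`. -/
noncomputable def cubeFlow (t : ℝ) (q : Fin d → ℝ) : Fin d → ℝ := fun i => latticeFlow t (q i)

theorem continuous_cubeFlow :
    Continuous (Function.uncurry (cubeFlow : ℝ → (Fin d → ℝ) → Fin d → ℝ)) :=
  continuous_pi fun i => continuous_latticeFlow.comp
    (continuous_fst.prodMk ((continuous_apply i).comp continuous_snd))

theorem cubeFlow_zero (q : Fin d → ℝ) : cubeFlow 0 q = q := funext fun _ => latticeFlow_zero _

theorem cubeFlow_add (s t : ℝ) (q : Fin d → ℝ) :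
    cubeFlow (s + t) q = cubeFlow s (cubeFlow t q) := funext fun _ => latticeFlow_add _ _ _

theorem cubeFlow_mem_Rplus {q : Fin d → ℝ} (hq : q ∈ Rplus d) (t : ℝ) : cubeFlow t q ∈ Rplus d :=
  fun i => latticeFlow_nonneg (hq i)

theorem isInwardFlow_cubeHull (A : Finset (Fin d → ℤ)) :
    IsInwardFlow cubeFlow (cubeHull A (1 / 4)) where
  continuous := continuous_cubeFlow
  zero := cubeFlow_zero
  add := cubeFlow_add
  closed := (isCompact_cubeHull A (by norm_num)).isClosed
  inward := by
    rintro q ⟨m, hm, hq⟩ t ht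
    refine mem_interior.2 ⟨⋂ i, {q | intervalDist (m i) (q i) < 1 / 4}, fun p hp =>
      ⟨m, hm, fun i => (mem_iInter.1 hp i).le⟩, isOpen_iInter_of_finite fun i =>
      isOpen_lt (continuous_intervalDist_apply m i) continuous_const, mem_iInter.2 fun i => ?_⟩
    change intervalDist (m i) (latticeFlow t (q i)) < 1 / 4
    rcases (intervalDist_nonneg (m i) (q i)).lt_or_eq with h | h
    · exact (intervalDist_latticeFlow_lt ht h (by linarith [hq i])).trans_le (hq i)
    · rw [intervalDist_latticeFlow_of_eq_zero t h.symm]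
      norm_num

theorem intervalPenalty_cubeFlow_le {t : ℝ} (ht : 0 < t) {m : Fin d → ℤ} {q : Fin d → ℝ}
    (h : 0 < cubeLevel m q) (i : Fin d) :
    intervalPenalty (m i) (cubeFlow t q i) ≤ intervalPenalty (m i) (q i) :=
  expNegInvGlue.monotone (intervalDist_latticeFlow_le ht (intervalDist_lt_half h i))

theorem cubeBump_le_cubeFlow {t : ℝ} (ht : 0 < t) (m : Fin d → ℤ) (q : Fin d → ℝ) :
    cubeBump m q ≤ cubeBump m (cubeFlow t q) := by
  rcases le_or_gt (cubeLevel m q) 0 with h | h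
  · rw [cubeBump, expNegInvGlue.zero_of_nonpos h]
    exact cubeBump_nonneg _ _
  · exact expNegInvGlue.monotone (sub_le_sub_left
      (Finset.sum_le_sum fun i _ => intervalPenalty_cubeFlow_le ht h i) _)

theorem cubeSmoothing_cubeFlow_pos {A : Finset (Fin d → ℤ)} {t : ℝ} (ht : 0 < t)
    {q : Fin d → ℝ} (h : 0 ≤ cubeSmoothing A q) : 0 < cubeSmoothing A (cubeFlow t q) := by
  obtain ⟨m, hm, hpos⟩ := exists_cubeLevel_pos h
  by_cases h0 : ∀ i, intervalDist (m i) (q i) = 0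
  · refine lt_of_lt_of_le ?_ (cubeSmoothing_lower hm _)
    rw [cubeBump_of_forall_eq_zero (q := cubeFlow t q) fun i =>
      intervalDist_latticeFlow_of_eq_zero t (h0 i)]
    linarith [bump_height_pos]
  · push Not at h0
    obtain ⟨i, hi⟩ := h0
    refine h.trans_lt (sub_lt_sub_right
      (Finset.sum_lt_sum (fun m _ => cubeBump_le_cubeFlow ht m q) ⟨m, hm, ?_⟩) _)
    refine expNegInvGlue.lt_of_lt hpos.le (sub_lt_sub_left (Finset.sum_lt_sum
      (fun i _ => intervalPenalty_cubeFlow_le ht hpos i) ⟨i, Finset.mem_univ i, ?_⟩) _)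
    exact expNegInvGlue.lt_of_lt (intervalDist_nonneg _ _) (intervalDist_latticeFlow_lt ht
      (lt_of_le_of_ne (intervalDist_nonneg _ _) hi.symm) (intervalDist_lt_half hpos i))

theorem isInwardFlow_cubeSmoothing (A : Finset (Fin d → ℤ)) :
    IsInwardFlow cubeFlow {q | 0 ≤ cubeSmoothing A q} where
  continuous := continuous_cubeFlow
  zero := cubeFlow_zero
  add := cubeFlow_add
  closed := isClosed_le continuous_const (contDiff_cubeSmoothing A).continuous
  inward _ hq _ ht := mem_interior.2 ⟨{q | 0 < cubeSmoothing A q},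
    fun p (hp : 0 < cubeSmoothing A p) => hp.le,
    isOpen_lt continuous_const (contDiff_cubeSmoothing A).continuous,
    cubeSmoothing_cubeFlow_pos ht hq⟩

theorem isCompact_cubeSmoothing (A : Finset (Fin d → ℤ)) :
    IsCompact {q | 0 ≤ cubeSmoothing A q} := by
  refine (isCompact_cubeHull A (r := 1 / 2) (by norm_num)).of_isClosed_subset
    (isInwardFlow_cubeSmoothing A).closed fun q hq => ?_
  obtain ⟨m, hm, hpos⟩ := exists_cubeLevel_pos hq
  exact ⟨m, hm, fun i => (intervalDist_lt_half hpos i).le⟩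

theorem exists_cubeFlow_mem_cubeSmoothing {A : Finset (Fin d → ℤ)} {q : Fin d → ℝ}
    (hq : q ∈ cubeHull A (1 / 4)) : ∃ t, 0 ≤ cubeSmoothing A (cubeFlow t q) := by
  obtain ⟨m, hm, hq⟩ := hq
  have hpen : ∀ i, Tendsto (fun t => intervalPenalty (m i) (cubeFlow t q i)) atTop (𝓝 0) := by
    intro i
    have h := tendsto_intervalDist_latticeFlow (m := m i) (s := q i) (by linarith [hq i])
    have hc : Continuous expNegInvGlue := (expNegInvGlue.contDiff (n := 0)).continuous
    exact expNegInvGlue.zero ▸ (hc.tendsto 0).comp h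
  have hlev : Tendsto (fun t => cubeBump m (cubeFlow t q)) atTop
      (𝓝 (expNegInvGlue (expNegInvGlue (1 / 2)))) := by
    have hc : Continuous expNegInvGlue := (expNegInvGlue.contDiff (n := 0)).continuous
    have h := (tendsto_finsetSum Finset.univ fun i _ => hpen i).const_sub (expNegInvGlue (1 / 2))
    rw [Finset.sum_const_zero, sub_zero] at h
    exact (hc.tendsto _).comp h
  obtain ⟨t, ht⟩ := (hlev.eventually (lt_mem_nhds (half_lt_self bump_height_pos))).exists
  exact ⟨t, (sub_nonneg.2 ht.le).trans (cubeSmoothing_lower hm _)⟩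

theorem exists_cubeFlow_mem_cubeHull {A : Finset (Fin d → ℤ)} {q : Fin d → ℝ}
    (hq : 0 ≤ cubeSmoothing A q) : ∃ t, cubeFlow t q ∈ cubeHull A (1 / 4) := by
  obtain ⟨m, hm, hpos⟩ := exists_cubeLevel_pos hq
  have h : ∀ᶠ t in atTop, ∀ i, intervalDist (m i) (latticeFlow t (q i)) ≤ 1 / 4 :=
    eventually_all.2 fun i => (tendsto_intervalDist_latticeFlow
      (intervalDist_lt_half hpos i)).eventually (ge_mem_nhds (by norm_num))
  obtain ⟨t, ht⟩ := h.exists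
  exact ⟨t, m, hm, ht⟩

/-- A union of cubes is identified with its smoothing by a map preserving `ℝ^d_+`. -/
theorem exists_cubeHull_image_eq (A : Finset (Fin d → ℤ)) :
    ∃ h : (Fin d → ℝ) → Fin d → ℝ, Continuous h ∧ InjOn h (cubeHull A (1 / 4)) ∧
      h '' (cubeHull A (1 / 4) ∩ Rplus d) = {q | 0 ≤ cubeSmoothing A q} ∩ Rplus d := by
  have hM := isInwardFlow_cubeHull A
  have hN := isInwardFlow_cubeSmoothing A
  obtain ⟨S, hS⟩ := hN.exists_forall_mem (isCompact_cubeHull A (by norm_num))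
    fun q hq => exists_cubeFlow_mem_cubeSmoothing hq
  obtain ⟨T, hT⟩ := hM.exists_forall_mem (isCompact_cubeSmoothing A)
    fun q hq => exists_cubeFlow_mem_cubeHull hq
  obtain ⟨τ, hτ, hinj, himg⟩ := hM.exists_sliding hN
    (T := max 1 (max S T)) (lt_of_lt_of_le one_pos (le_max_left _ _))
    (hS _ ((le_max_left _ _).trans (le_max_right _ _)))
    (hT _ ((le_max_right _ _).trans (le_max_right _ _)))
  refine ⟨fun q => cubeFlow (τ q) q, continuous_cubeFlow.comp (hτ.prodMk continuous_id), hinj,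
    Subset.antisymm ?_ ?_⟩
  · rintro _ ⟨q, ⟨hq, hq'⟩, rfl⟩
    exact ⟨himg ▸ mem_image_of_mem _ hq, cubeFlow_mem_Rplus hq' _⟩
  · rintro y ⟨hy, hy'⟩
    obtain ⟨q, hq, rfl⟩ := himg.symm ▸ hy
    refine ⟨q, ⟨hq, ?_⟩, rfl⟩
    have h := cubeFlow_mem_Rplus hy' (-τ q)
    simpa only [← cubeFlow_add, neg_add_cancel, cubeFlow_zero] using h

end Cubes

section Assembly

variable {d : ℕ}

theorem smul_mem_Rplus_iff {c : ℝ} (hc : 0 < c) {y : Fin d → ℝ} :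
    c • y ∈ Rplus d ↔ y ∈ Rplus d :=
  forall_congr' fun i => by simp [hc]

theorem isClosed_Rplus : IsClosed (Rplus d) := by
  simp only [Rplus, Set.ofPred_forall]
  exact isClosed_iInter fun i => isClosed_le continuous_const (continuous_apply i)

/-- The open `1 / 4`-neighbourhood of the union of the unit cubes with lower corners in `A`. -/
def openCubeHull (A : Finset (Fin d → ℤ)) : Set (Fin d → ℝ) :=
  {q | ∃ m ∈ A, ∀ i, intervalDist (m i) (q i) < 1 / 4}

theorem isOpen_openCubeHull (A : Finset (Fin d → ℤ)) : IsOpen (openCubeHull A) := by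
  have : openCubeHull A = ⋃ m ∈ A, ⋂ i, {q | intervalDist (m i) (q i) < 1 / 4} := by
    ext q
    simp [openCubeHull]
  rw [this]
  exact isOpen_biUnion fun m _ => isOpen_iInter_of_finite fun i =>
    isOpen_lt (continuous_intervalDist_apply m i) continuous_const

theorem closure_openCubeHull_inter_Rplus {A : Finset (Fin d → ℤ)} (hA : ∀ m ∈ A, ∀ i, 0 ≤ m i) :
    closure (openCubeHull A ∩ Rplus d) = cubeHull A (1 / 4) ∩ Rplus d := by
  refine Subset.antisymm (closure_minimal ?_
    ((isCompact_cubeHull A (by norm_num)).isClosed.inter isClosed_Rplus)) ?_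
  · rintro q ⟨⟨m, hm, hq⟩, hq'⟩
    exact ⟨⟨m, hm, fun i => (hq i).le⟩, hq'⟩
  · rintro q ⟨⟨m, hm, hq⟩, hq'⟩
    have hlim : Tendsto (fun (s : ℝ) i => q i + s * (m i + 1 / 2 - q i)) (𝓝[>] 0) (𝓝 q) := by
      have hc : Continuous fun (s : ℝ) i => q i + s * (m i + 1 / 2 - q i) := by fun_prop
      simpa using (hc.tendsto 0).mono_left nhdsWithin_le_nhds
    refine mem_closure_of_tendsto hlim ?_
    filter_upwards [Ioo_mem_nhdsGT one_pos] with s hs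
    refine ⟨⟨m, hm, fun i => ?_⟩, fun i => ?_⟩
    · have h := (intervalDist_le_iff (by norm_num)).1 (hq i)
      refine (intervalDist_lt_iff (by norm_num)).2 ⟨?_, ?_⟩ <;>
        nlinarith [h.1, h.2, hs.1, hs.2]
    · have h : (0 : ℝ) ≤ m i := by exact_mod_cast hA m hm i
      have h' := hq' i
      have := mul_nonneg (sub_nonneg.2 hs.2.le) h'
      have := mul_nonneg hs.1.le h
      change 0 ≤ q i + s * (m i + 1 / 2 - q i)
      linarith [hs.1]

theorem nonempty_cornersManifold_smul_preimage_cubeHull (A : Finset (Fin d → ℤ)) {c : ℝ}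
    (hc : c ≠ 0) : Nonempty (CornersManifold d
      ↥((fun y : Fin d → ℝ => c • y) ⁻¹' (cubeHull A (1 / 4) ∩ Rplus d))) := by
  obtain ⟨h, hh, hinj, himg⟩ := exists_cubeHull_image_eq A
  set K := cubeHull A (1 / 4) ∩ Rplus d
  let e : (Fin d → ℝ) ≃ₜ (Fin d → ℝ) := Homeomorph.smulOfNeZero c hc
  have hK : IsCompact K := (isCompact_cubeHull A (by norm_num)).inter_right isClosed_Rplus
  have : CompactSpace ↥(e ⁻¹' K) := isCompact_iff_compactSpace.1 (e.isCompact_preimage.2 hK)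
  have hcont : Continuous fun y : ↥(e ⁻¹' K) => h (e y) :=
    hh.comp (e.continuous.comp continuous_subtype_val)
  refine nonempty_cornersManifold_of_superlevel (X := ↥(e ⁻¹' K)) (H := fun y => h (e y))
    (hcont.isClosedEmbedding fun y z hyz => Subtype.ext (e.injective
      (hinj y.2.1 z.2.1 hyz))).isEmbedding
    (contDiff_cubeSmoothing A) ?_ fun p hp => exists_fderiv_cubeSmoothing_ne_zero hp
  rw [← himg]
  conv_rhs => rw [← image_preimage_eq K e.surjective, image_image]
  exact (image_eq_range (fun x => h (e x)) (e ⁻¹' K)).symm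

theorem mem_cornerCube_iff {ε : ℝ} (hε : 0 < ε) (m : Fin d → ℤ) (y : Fin d → ℝ) :
    y ∈ cornerCube (fun i => ε * (m i + 1 / 2)) (3 * ε / 4) ↔
      (∀ i, intervalDist (m i) ((ε⁻¹ • y) i) ≤ 1 / 4) ∧ ε⁻¹ • y ∈ Rplus d := by
  rw [smul_mem_Rplus_iff (inv_pos.2 hε)]
  refine and_congr_left fun _ => forall_congr' fun i => ?_
  rw [intervalDist_le_iff (by norm_num), Pi.smul_apply, smul_eq_mul, mem_Icc, mem_Icc,
    le_inv_mul_iff₀ hε, inv_mul_le_iff₀ hε]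
  refine and_congr ?_ ?_ <;> constructor <;> intro h <;> linarith

theorem exists_finset_floor {C : Set (Fin d → ℝ)} (hC : IsCompact C) {c : ℝ} (hc : 0 ≤ c) :
    ∃ A : Finset (Fin d → ℤ), ∀ m, m ∈ A ↔ ∃ q ∈ C, (fun i => ⌊c * q i⌋) = m := by
  obtain ⟨R, hR⟩ := hC.isBounded.subset_closedBall 0
  have hfin : ((fun (q : Fin d → ℝ) i => ⌊c * q i⌋) '' C).Finite := by
    refine (finite_Icc (fun _ => ⌊c * -R⌋) fun _ => ⌊c * R⌋).subset ?_
    rintro _ ⟨q, hq, rfl⟩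
    have h i := abs_le.1 ((norm_le_pi_norm q i).trans (mem_closedBall_zero_iff.1 (hR hq)))
    exact ⟨fun i => Int.floor_mono (mul_le_mul_of_nonneg_left (h i).1 hc),
      fun i => Int.floor_mono (mul_le_mul_of_nonneg_left (h i).2 hc)⟩
  exact ⟨hfin.toFinset, fun m => by simp⟩

end Assembly

/-- **Squeezing-in manifolds with corners** (Lemma).  Let `W` be an open neighborhood of a
point `x` in `ℝ^d_+` and `C ⊆ W` a compact set containing `x`.  Then there is a relatively
open set `V` of `ℝ^d_+` with `x ∈ C ⊆ V ⊆ closure V ⊆ W` whose closure is a compact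
manifold with corners; in fact the closure can be taken to be a finite union of closed
axis-parallel cubes intersected with `ℝ^d_+`. -/
theorem squeezing_in_manifolds_with_corners
    {d : ℕ} (x : Fin d → ℝ) (W : Set (Fin d → ℝ))
    (hxW : x ∈ W) (hWsub : W ⊆ Rplus d)
    (hWopen : ∃ O : Set (Fin d → ℝ), IsOpen O ∧ W = O ∩ Rplus d)
    (C : Set (Fin d → ℝ)) (hC : IsCompact C) (hCW : C ⊆ W) (hxC : x ∈ C) :
    ∃ V : Set (Fin d → ℝ),
      (∃ O : Set (Fin d → ℝ), IsOpen O ∧ V = O ∩ Rplus d) ∧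
      C ⊆ V ∧ closure V ⊆ W ∧ IsCompact (closure V) ∧
      Nonempty (CornersManifold d ↥(closure V)) ∧
      ∃ s : Finset ((Fin d → ℝ) × ℝ), (∀ p ∈ s, 0 < p.2) ∧
        closure V = ⋃ p ∈ s, cornerCube p.1 p.2 := by
  obtain ⟨O, hO, rfl⟩ := hWopen
  obtain ⟨η, hη, hηO⟩ := hC.exists_thickening_subset_open hO (hCW.trans inter_subset_left)
  set ε := η / 2 with hε_def
  have hε : 0 < ε := half_pos hη
  obtain ⟨A, hA⟩ := exists_finset_floor hC (inv_pos.2 hε).le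
  have hA0 : ∀ m ∈ A, ∀ i, 0 ≤ m i := by
    intro m hm i
    obtain ⟨q, hq, rfl⟩ := (hA m).1 hm
    exact Int.floor_nonneg.2 (mul_nonneg (inv_pos.2 hε).le ((hCW hq).2 i))
  let e : (Fin d → ℝ) ≃ₜ (Fin d → ℝ) := Homeomorph.smulOfNeZero ε⁻¹ (inv_pos.2 hε).ne'
  have hclosure : closure (e ⁻¹' (openCubeHull A ∩ Rplus d)) =
      e ⁻¹' (cubeHull A (1 / 4) ∩ Rplus d) := by
    rw [← e.preimage_closure, closure_openCubeHull_inter_Rplus hA0]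
  have he : e ⁻¹' Rplus d = Rplus d := ext fun y => smul_mem_Rplus_iff (inv_pos.2 hε)
  refine ⟨e ⁻¹' (openCubeHull A ∩ Rplus d),
    ⟨e ⁻¹' openCubeHull A, (isOpen_openCubeHull A).preimage e.continuous, ?_⟩, ?_, ?_, ?_, ?_,
    A.image fun m => (fun i => ε * (m i + 1 / 2), 3 * ε / 4), ?_, ?_⟩
  · rw [preimage_inter, he]
  · intro q hq
    refine ⟨⟨_, (hA _).2 ⟨q, hq, rfl⟩, fun i => ?_⟩, (he.symm ▸ (hCW hq).2 : q ∈ e ⁻¹' Rplus d)⟩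
    change intervalDist ⌊ε⁻¹ * q i⌋ (ε⁻¹ * q i) < 1 / 4
    rw [intervalDist_of_mem ⟨Int.floor_le _, (Int.lt_floor_add_one _).le⟩]
    norm_num
  · rw [hclosure, preimage_inter, he]
    refine inter_subset_inter_left _ fun y hy => hηO ?_
    obtain ⟨m, hm, hy⟩ := hy
    obtain ⟨q, hq, rfl⟩ := (hA m).1 hm
    refine Metric.mem_thickening_iff.2 ⟨q, hq, (dist_pi_lt_iff hη).2 fun i => ?_⟩
    have h1 : ε⁻¹ * y i ∈ Icc _ _ := (intervalDist_le_iff (by norm_num)).1 (hy i)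
    have h2 := Int.floor_le (ε⁻¹ * q i)
    have h3 := Int.lt_floor_add_one (ε⁻¹ * q i)
    have h4 : |ε⁻¹ * y i - ε⁻¹ * q i| < 2 := abs_lt.2 ⟨by linarith [h1.1], by linarith [h1.2]⟩
    rw [← mul_sub, abs_mul, abs_of_pos (inv_pos.2 hε), inv_mul_lt_iff₀ hε] at h4
    rw [Real.dist_eq]
    linarith
  · rw [hclosure, e.isCompact_preimage]
    exact (isCompact_cubeHull A (by norm_num)).inter_right isClosed_Rplus
  · rw [hclosure]
    exact nonempty_cornersManifold_smul_preimage_cubeHull A (inv_pos.2 hε).ne'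
  · intro p hp
    obtain ⟨m, -, rfl⟩ := Finset.mem_image.1 hp
    change 0 < 3 * ε / 4
    positivity
  · rw [hclosure]
    ext y
    simp only [Finset.mem_image, iUnion_exists, biUnion_and', iUnion_iUnion_eq_right, mem_iUnion,
      mem_cornerCube_iff hε, exists_prop]
    constructor
    · rintro ⟨⟨m, hm, hy⟩, hy'⟩
      exact ⟨m, hm, hy, hy'⟩
    · rintro ⟨m, hm, hy, hy'⟩
      exact ⟨⟨m, hm, hy⟩, hy'⟩
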